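/- Let S ⊆ Matrix ι ι ℂ be the block *-algebra ⊕_k (1_{d k} ⊗ M_{m k}(ℂ)) of the context. Then the entanglement-assisted independence number of S equals ∑_k (d k)²; that is: (i) there exist n, r ≥ 1, a state ρ on Fin n, and isometries V : Fin (∑_k (d k)²) → Matrix (ι × Fin r) (Fin n) ℂ with (V i)ᴴ * V i = 1 for all i, such that for all distinct i, i', every Y ∈ S and every W : Matrix (Fin r) (Fin r) ℂ satisfy trace ((Y ⊗ₖ W)ᴴ * (V i * ρ * (V i')ᴴ)) = 0; and (ii) for any M, n, r, state ρ on Fin n and isometries V : Fin M → Matrix (ι × Fin r) (Fin n) ℂ with this orthogonality property, M ≤ ∑_k (d k)². (Part of the paper's Lemma computing the independence numbers of *-algebras: α_ea(S) = ∑_k d_k².) -/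

import Mathlib

open Matrix Kronecker ComplexOrder

noncomputable section

/-- The index type of the block decomposition `⊕ₖ (Fin (d k) × Fin (m k))`. -/
abbrev BlockIdx {K : ℕ} (d m : Fin K → ℕ) : Type :=
  (k : Fin K) × (Fin (d k) × Fin (m k))

/-- The matrix supported on the diagonal block `k`, where it equals `1_{d k} ⊗ B`. -/
def blockMatrix {K : ℕ} (d m : Fin K → ℕ) (k : Fin K)
    (B : Matrix (Fin (m k)) (Fin (m k)) ℂ) :
    Matrix (BlockIdx d m) (BlockIdx d m) ℂ := fun p q =>
  if hp : p.1 = k then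
    if hq : q.1 = k then
      if Fin.cast (congrArg d hp) p.2.1 = Fin.cast (congrArg d hq) q.2.1 then
        B (Fin.cast (congrArg m hp) p.2.2) (Fin.cast (congrArg m hq) q.2.2)
      else 0
    else 0
  else 0

/-- The block *-algebra `⊕ₖ (1_{d k} ⊗ M_{m k}(ℂ))`, as the span of the single-block
matrices `blockMatrix d m k B`. -/
def blockAlgebra {K : ℕ} (d m : Fin K → ℕ) :
    Submodule ℂ (Matrix (BlockIdx d m) (BlockIdx d m) ℂ) :=
  Submodule.span ℂ
    {A | ∃ (k : Fin K) (B : Matrix (Fin (m k)) (Fin (m k)) ℂ), A = blockMatrix d m k B}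

/-- A state: a positive semidefinite matrix of trace one. -/
def IsState {ι : Type*} [Fintype ι] (ρ : Matrix ι ι ℂ) : Prop :=
  ρ.PosSemidef ∧ ρ.trace = 1

/-- An independent family of states for a subspace `S` of matrices: the `|v⟩⟨w|` built from
vectors in the ranges of two distinct members are Hilbert–Schmidt orthogonal to `S`. -/
def IsIndepFamily {ι : Type*} [Fintype ι] (S : Submodule ℂ (Matrix ι ι ℂ))
    {M : ℕ} (ρ : Fin M → Matrix ι ι ℂ) : Prop :=
  (∀ i, IsState (ρ i)) ∧
  ∀ i j : Fin M, i ≠ j →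
    ∀ v ∈ Set.range (ρ i).mulVec, ∀ w ∈ Set.range (ρ j).mulVec,
      ∀ Y ∈ S, Matrix.trace (Yᴴ * Matrix.vecMulVec v (star w)) = 0

/-- A private independent family: an independent family whose state differences are also
orthogonal to `S`. -/
def IsPrivateIndepFamily {ι : Type*} [Fintype ι] (S : Submodule ℂ (Matrix ι ι ℂ))
    {M : ℕ} (ρ : Fin M → Matrix ι ι ℂ) : Prop :=
  IsIndepFamily S ρ ∧
  ∀ i j : Fin M, i ≠ j → ∀ Y ∈ S, Matrix.trace (Yᴴ * (ρ i - ρ j)) = 0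

/-- A Knill–Laflamme projection for `S`: an orthogonal projection `P` with `P S P ⊆ ℂ P`. -/
def IsKLProjection {ι : Type*} [Fintype ι] (S : Submodule ℂ (Matrix ι ι ℂ))
    (P : Matrix ι ι ℂ) : Prop :=
  Pᴴ = P ∧ P * P = P ∧ ∀ Y ∈ S, ∃ c : ℂ, P * Y * P = c • P

/-- An entanglement-assisted independent family of size `M` for `S`. -/
def IsEAIndepFamily {ι : Type*} [Fintype ι] [DecidableEq ι]
    (S : Submodule ℂ (Matrix ι ι ℂ)) (M : ℕ) : Prop :=
  ∃ (n r : ℕ), 1 ≤ n ∧ 1 ≤ r ∧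
    ∃ ρ : Matrix (Fin n) (Fin n) ℂ, IsState ρ ∧
      ∃ V : Fin M → Matrix (ι × Fin r) (Fin n) ℂ,
        (∀ i, (V i)ᴴ * V i = 1) ∧
        ∀ i i' : Fin M, i ≠ i' → ∀ Y ∈ S, ∀ W : Matrix (Fin r) (Fin r) ℂ,
          Matrix.trace ((Y ⊗ₖ W)ᴴ * (V i * ρ * (V i')ᴴ)) = 0

end

/-- Hermitian matrices have a commuting Hermitian pseudo-inverse. -/
lemma ea_pinv {E : Type*} [Fintype E] [DecidableEq E] (G : Matrix E E ℂ) (hG : G.IsHermitian) :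
    ∃ H : Matrix E E ℂ, Hᴴ = H ∧ G * H = H * G ∧ G * H * G = G := by
  have hs := hG.spectral_theorem
  rw [Unitary.conjStarAlgAut_apply] at hs
  set U : Matrix E E ℂ := (hG.eigenvectorUnitary : Matrix E E ℂ) with hU
  have hUU : star U * U = 1 := Unitary.coe_star_mul_self _
  set D : Matrix E E ℂ := diagonal (RCLike.ofReal ∘ hG.eigenvalues) with hD
  let D' : Matrix E E ℂ := diagonal (fun i => ((hG.eigenvalues i)⁻¹ : ℂ))
  have key : ∀ X Y : Matrix E E ℂ, U * X * star U * (U * Y * star U) = U * (X * Y) * star U := by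
    intro X Y
    calc U * X * star U * (U * Y * star U) = U * X * (star U * U) * Y * star U := by
          simp only [Matrix.mul_assoc]
      _ = _ := by rw [hUU]; simp only [Matrix.mul_assoc, Matrix.one_mul]
  have hs' : G = U * D * star U := hs
  refine ⟨U * D' * star U, ?_, ?_, ?_⟩
  · rw [star_eq_conjTranspose, conjTranspose_mul, conjTranspose_mul, conjTranspose_conjTranspose]
    have : D'ᴴ = D' := by
      simp only [D', diagonal_conjTranspose]
      congr 1; ext i; simp
    rw [this, Matrix.mul_assoc]
  · rw [hs', key, key]
    congr 2
    simp only [D', hD, diagonal_mul_diagonal]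
    congr 1; ext i; simp [mul_comm]
  · rw [hs', key, key]
    congr 2
    simp only [D', hD, diagonal_mul_diagonal]
    congr 1; ext i
    by_cases h : (hG.eigenvalues i : ℂ) = 0
    · simp [h]
    · simp [h]

lemma ea_trace_bound {E I : Type*} [Fintype E] [DecidableEq E] [Fintype I] [DecidableEq I]
    (G : I → Matrix E E ℂ) (T : Matrix E E ℂ) (hG : ∀ i, (G i).IsHermitian) (hT : T.PosSemidef)
    (horth : ∀ i j, i ≠ j → G i * G j = 0) (hle : ∀ i, (T - G i).PosSemidef) :
    ∑ i, (G i).trace ≤ T.trace := by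
  choose H hH1 hH2 hH3 using fun i => ea_pinv (G i) (hG i)
  let P : I → Matrix E E ℂ := fun i => G i * H i
  have hPh : ∀ i, (P i)ᴴ = P i := by
    intro i
    simp only [P]
    rw [conjTranspose_mul, hH1, (hG i).eq, hH2]
  have hPP : ∀ i, P i * P i = P i := by
    intro i
    simp only [P]
    rw [← Matrix.mul_assoc, hH3]
  have hPG : ∀ i, P i * G i * P i = G i := by
    intro i
    simp only [P]
    rw [hH3, hH2, ← Matrix.mul_assoc, hH3]
  have hPo : ∀ i j, i ≠ j → P i * P j = 0 := by
    intro i j hij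
    simp only [P]
    rw [hH2, Matrix.mul_assoc, ← Matrix.mul_assoc (G i), horth i j hij]; simp
  let Q := ∑ i, P i
  have hQh : Qᴴ = Q := by simp [Q, conjTranspose_sum, hPh]
  have hQQ : Q * Q = Q := by
    simp only [Q, Finset.sum_mul, Finset.mul_sum]
    refine Finset.sum_congr rfl fun i _ => ?_
    rw [Finset.sum_eq_single i]
    · exact hPP i
    · intro j _ hj; exact hPo _ _ hj
    · simp
  have tr1 : ∀ R : Matrix E E ℂ, R * R = R → (R * T * R).trace = (R * T).trace := by
    intro R hR
    rw [trace_mul_comm, ← Matrix.mul_assoc, hR]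
  have h1 : 0 ≤ ((1 - Q) * T * (1 - Q)).trace := by
    have := (hT.conjTranspose_mul_mul_same (1 - Q)).trace_nonneg
    rwa [conjTranspose_sub, conjTranspose_one, hQh] at this
  rw [tr1 _ (by rw [sub_mul, mul_sub, mul_sub, hQQ]; simp), sub_mul, Matrix.one_mul, trace_sub,
    sub_nonneg] at h1
  refine le_trans ?_ h1
  simp only [Q, Finset.sum_mul, trace_sum]
  refine Finset.sum_le_sum fun i _ => ?_
  rw [← tr1 _ (hPP i)]
  have := ((hle i).conjTranspose_mul_mul_same (P i)).trace_nonneg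
  rw [hPh, mul_sub, sub_mul, trace_sub, hPG, sub_nonneg] at this
  exact this

lemma blockMatrix_same {K : ℕ} (d m : Fin K → ℕ) (k : Fin K)
    (B : Matrix (Fin (m k)) (Fin (m k)) ℂ) (a a' : Fin (d k)) (b b' : Fin (m k)) :
    blockMatrix d m k B ⟨k, a, b⟩ ⟨k, a', b'⟩ = if a = a' then B b b' else 0 := by
  simp [blockMatrix]

lemma blockMatrix_left {K : ℕ} (d m : Fin K → ℕ) (k : Fin K)
    (B : Matrix (Fin (m k)) (Fin (m k)) ℂ) (p q : BlockIdx d m) (h : p.1 ≠ k) :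
    blockMatrix d m k B p q = 0 := by
  simp [blockMatrix, h]

lemma blockMatrix_right {K : ℕ} (d m : Fin K → ℕ) (k : Fin K)
    (B : Matrix (Fin (m k)) (Fin (m k)) ℂ) (p q : BlockIdx d m) (h : q.1 ≠ k) :
    blockMatrix d m k B p q = 0 := by
  simp [blockMatrix, h]

lemma ea_block_single {K : ℕ} (d m : Fin K → ℕ) (k : Fin K) (r : ℕ) (b b' : Fin (m k))
    (c c' : Fin r) :
    (blockMatrix d m k (single b b' 1)) ⊗ₖ (single c c' (1:ℂ)) =
      ∑ a : Fin (d k), single ((⟨k, a, b⟩ : BlockIdx d m), c) (⟨k, a, b'⟩, c') (1:ℂ) := by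
  ext ⟨⟨k₁, a₁, b₁⟩, c₁⟩ ⟨⟨k₂, a₂, b₂⟩, c₂⟩
  rw [kroneckerMap_apply, Matrix.sum_apply]
  by_cases h1 : k₁ = k
  · by_cases h2 : k₂ = k
    · subst h1; subst h2
      rw [blockMatrix_same]
      by_cases h : a₁ = a₂
      · subst h
        rw [Finset.sum_eq_single a₁]
        · simp only [single_apply, if_true]
          simp only [Prod.mk.injEq, Sigma.mk.injEq, heq_eq_eq, true_and]
          split_ifs <;> simp_all
        · intro a _ ha
          simp [single_apply, ha]
        · simp
      · rw [if_neg h, zero_mul, eq_comm]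
        refine Finset.sum_eq_zero fun a _ => ?_
        rw [single_apply, if_neg]
        rintro ⟨h1, h2⟩
        simp at h1 h2
        exact h (h1.1.1.symm.trans h2.1.1)
    · rw [blockMatrix_right _ _ _ _ _ _ h2, zero_mul, eq_comm]
      refine Finset.sum_eq_zero fun a _ => ?_
      rw [single_apply, if_neg]
      rintro ⟨h3, h4⟩
      exact h2 (congrArg (fun z => z.1.1) h4).symm
  · rw [blockMatrix_left _ _ _ _ _ _ h1, zero_mul, eq_comm]
    refine Finset.sum_eq_zero fun a _ => ?_
    rw [single_apply, if_neg]
    rintro ⟨h3, h4⟩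
    exact h1 (congrArg (fun z => z.1.1) h3).symm

/-- the reshaped block -/
def eaR {K : ℕ} {d m : Fin K → ℕ} {r n : ℕ} (A : Matrix (BlockIdx d m × Fin r) (Fin n) ℂ)
    (k : Fin K) : Matrix (Fin (m k) × Fin r) (Fin (d k) × Fin n) ℂ :=
  fun x y => A (⟨k, y.1, x.1⟩, x.2) y.2

lemma ea_R_orth {K : ℕ} {d m : Fin K → ℕ} {r n : ℕ}
    (A A' : Matrix (BlockIdx d m × Fin r) (Fin n) ℂ)
    (h : ∀ Y ∈ blockAlgebra d m, ∀ W : Matrix (Fin r) (Fin r) ℂ,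
      Matrix.trace ((Y ⊗ₖ W)ᴴ * (A * A'ᴴ)) = 0) (k : Fin K) :
    eaR A k * (eaR A' k)ᴴ = 0 := by
  ext ⟨b, c⟩ ⟨b', c'⟩
  have := h _ (Submodule.subset_span ⟨k, single b b' 1, rfl⟩) (single c c' 1)
  rw [ea_block_single, conjTranspose_sum, Finset.sum_mul, trace_sum] at this
  simp only [conjTranspose_single, star_one, trace_single_mul, one_mul, smul_eq_mul] at this
  rw [mul_apply, Fintype.sum_prod_type, Matrix.zero_apply, ← this]
  refine Finset.sum_congr rfl fun a _ => ?_
  rw [mul_apply]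
  rfl

lemma ea_R_le {K : ℕ} {d m : Fin K → ℕ} {r n : ℕ}
    (A : Matrix (BlockIdx d m × Fin r) (Fin n) ℂ) (k : Fin K) :
    ((d k : ℂ) • ((1 : Matrix (Fin (d k)) (Fin (d k)) ℂ) ⊗ₖ (Aᴴ * A)) -
      (eaR A k)ᴴ * eaR A k).PosSemidef := by
  have hn : ∀ {J : Type} [Fintype J] (w : J → ℂ), star w ⬝ᵥ w = ((∑ j, ‖w j‖ ^ 2 : ℝ) : ℂ) := by
    intro J _ w
    simp only [dotProduct, Pi.star_apply, Complex.ofReal_sum]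
    refine Finset.sum_congr rfl fun j _ => ?_
    rw [Complex.star_def, Complex.conj_mul']; push_cast; rfl
  have hq : ∀ {J J' : Type} [Fintype J] [Fintype J'] (B : Matrix J J' ℂ) (w : J' → ℂ),
      star w ⬝ᵥ ((Bᴴ * B) *ᵥ w) = ((∑ j, ‖(B *ᵥ w) j‖ ^ 2 : ℝ) : ℂ) := by
    intro J J' _ _ B w
    rw [← hn, star_mulVec, ← mulVec_mulVec, dotProduct_mulVec]
  refine PosSemidef.of_dotProduct_mulVec_nonneg ?_ fun v => ?_
  · rw [IsHermitian, conjTranspose_sub, conjTranspose_smul, conjTranspose_kronecker]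
    simp
  rw [sub_mulVec, dotProduct_sub, sub_nonneg, hq, smul_mulVec, dotProduct_smul]
  have h1 : star v ⬝ᵥ (((1 : Matrix (Fin (d k)) (Fin (d k)) ℂ) ⊗ₖ (Aᴴ * A)) *ᵥ v) =
      ((∑ a, ∑ j, ‖(A *ᵥ fun s => v (a, s)) j‖ ^ 2 : ℝ) : ℂ) := by
    rw [Complex.ofReal_sum]
    simp only [← hq]
    rw [dotProduct, Fintype.sum_prod_type]
    refine Finset.sum_congr rfl fun a _ => ?_
    rw [dotProduct]
    refine Finset.sum_congr rfl fun s _ => ?_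
    congr 1
    rw [mulVec, dotProduct, Fintype.sum_prod_type, Finset.sum_eq_single a]
    · simp [mulVec, dotProduct]
    · intro a' _ ha'
      simp [one_apply_ne ha'.symm]
    · simp
  rw [h1, smul_eq_mul, ← Complex.ofReal_natCast, ← Complex.ofReal_mul, Complex.real_le_real]
  have h2 : ∀ x : Fin (m k) × Fin r, ‖(eaR A k *ᵥ v) x‖ ^ 2 ≤
      d k * ∑ a, ‖(A *ᵥ fun s => v (a, s)) (⟨k, a, x.1⟩, x.2)‖ ^ 2 := by
    intro x
    have : (eaR A k *ᵥ v) x = ∑ a, (A *ᵥ fun s => v (a, s)) (⟨k, a, x.1⟩, x.2) := by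
      rw [mulVec, dotProduct, Fintype.sum_prod_type]; rfl
    rw [this]
    refine (pow_le_pow_left₀ (norm_nonneg _) (norm_sum_le _ _) 2).trans ?_
    refine sq_sum_le_card_mul_sum_sq.trans ?_
    simp
  refine (Finset.sum_le_sum fun x _ => h2 x).trans ?_
  rw [← Finset.mul_sum, Finset.sum_comm]
  refine mul_le_mul_of_nonneg_left (Finset.sum_le_sum fun a _ => ?_) (by positivity)
  let f : Fin (m k) × Fin r ↪ BlockIdx d m × Fin r :=
    ⟨fun x => (⟨k, a, x.1⟩, x.2), by
      rintro ⟨b, c⟩ ⟨b', c'⟩ h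
      simpa using h⟩
  have := Finset.sum_map Finset.univ f (fun j => ‖(A *ᵥ fun s => v (a, s)) j‖ ^ 2)
  refine (le_of_eq this.symm).trans ?_
  exact Finset.sum_le_sum_of_subset_of_nonneg (Finset.subset_univ _) fun _ _ _ => by positivity

lemma ea_R_trace {K : ℕ} {d m : Fin K → ℕ} {r n : ℕ}
    (A : Matrix (BlockIdx d m × Fin r) (Fin n) ℂ) :
    ∑ k, ((eaR A k)ᴴ * eaR A k).trace = (Aᴴ * A).trace := by
  simp only [trace, diag, mul_apply, Fintype.sum_prod_type, Fintype.sum_sigma, eaR,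
    conjTranspose_apply]
  rw [Finset.sum_comm (s := (Finset.univ : Finset (Fin n)))]
  refine Finset.sum_congr rfl fun k _ => ?_
  rw [Finset.sum_comm (s := (Finset.univ : Finset (Fin n)))]

open scoped MatrixOrder Matrix.Norms.L2Operator in
lemma ea_factor {n : ℕ} {ρ : Matrix (Fin n) (Fin n) ℂ} (hρ : ρ.PosSemidef) :
    ∃ B : Matrix (Fin n) (Fin n) ℂ, ρ = Bᴴ * B :=
  CStarAlgebra.nonneg_iff_eq_star_mul_self.mp hρ.nonneg

lemma ea_upper {K : ℕ} (d m : Fin K → ℕ) (M : ℕ) (h : IsEAIndepFamily (blockAlgebra d m) M) :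
    M ≤ ∑ k, (d k) ^ 2 := by
  obtain ⟨n, r, -, -, ρ, ⟨hρ, htr⟩, V, hV, horth⟩ := h
  obtain ⟨B, hB⟩ := ea_factor hρ
  let A := fun i => V i * Bᴴ
  let τ := B * Bᴴ
  have hτ : ∀ i, (A i)ᴴ * A i = τ := by
    intro i
    simp only [A, τ]
    rw [conjTranspose_mul, conjTranspose_conjTranspose, Matrix.mul_assoc,
      ← Matrix.mul_assoc (V i)ᴴ, hV, Matrix.one_mul]
  have hτt : τ.trace = 1 := by
    simp only [τ]; rw [trace_mul_comm, ← hB, htr]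
  have hk : ∀ k, ∑ i, ((eaR (A i) k)ᴴ * eaR (A i) k).trace ≤ (d k : ℂ) ^ 2 := by
    intro k
    have := ea_trace_bound (fun i => (eaR (A i) k)ᴴ * eaR (A i) k)
      ((d k : ℂ) • ((1 : Matrix (Fin (d k)) (Fin (d k)) ℂ) ⊗ₖ τ))
      (fun i => isHermitian_conjTranspose_mul_self _)
      (((PosSemidef.one).kronecker (posSemidef_self_mul_conjTranspose B)).smul
        (by exact_mod_cast Nat.zero_le _)) ?_ ?_
    · refine this.trans (le_of_eq ?_)
      rw [trace_smul, trace_kronecker, hτt, trace_one]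
      simp [sq]
    · intro i j hij
      have h0 := ea_R_orth (A i) (A j) (fun Y hY W => by
        rw [← horth i j hij Y hY W, hB]
        simp only [A, conjTranspose_mul, conjTranspose_conjTranspose, Matrix.mul_assoc]) k
      calc _ = (eaR (A i) k)ᴴ * (eaR (A i) k * (eaR (A j) k)ᴴ) * eaR (A j) k := by
            simp only [Matrix.mul_assoc]
        _ = 0 := by rw [h0]; simp
    · intro i
      rw [← hτ i]
      exact ea_R_le (A i) k
  have hs := Finset.sum_le_sum fun k (_ : k ∈ Finset.univ) => hk k
  rw [Finset.sum_comm] at hs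
  simp only [ea_R_trace, hτ, hτt] at hs
  simp at hs
  exact_mod_cast hs

lemma ea_root_sum (D : ℕ) (hD : 1 ≤ D) (y y' : Fin D) (h : y ≠ y') :
    ∑ a : Fin D, star (Complex.exp (2 * Real.pi * Complex.I / D) ^ (y' * a : ℕ)) *
      Complex.exp (2 * Real.pi * Complex.I / D) ^ (y * a : ℕ) = 0 := by
  set ω := Complex.exp (2 * Real.pi * Complex.I / D) with hω
  have hp : IsPrimitiveRoot ω D := Complex.isPrimitiveRoot_exp D (by omega)
  have hn : star ω * ω = 1 := by
    rw [Complex.star_def, Complex.conj_mul', hp.norm'_eq_one (by omega)]; simp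
  let z := star (ω ^ (y' : ℕ)) * ω ^ (y : ℕ)
  have hz : z ≠ 1 := by
    intro hz
    have h2 : ω ^ (y' : ℕ) * z = ω ^ (y : ℕ) := by
      simp only [z]
      rw [← mul_assoc, star_pow, ← mul_pow, mul_comm ω, hn]; simp
    rw [hz, mul_one] at h2
    exact h (Fin.ext (hp.pow_inj y'.2 y.2 h2).symm)
  have hzD : z ^ D = 1 := by
    simp only [z]
    rw [mul_pow, ← star_pow, ← pow_mul, ← pow_mul, mul_comm _ D, mul_comm _ D, pow_mul, pow_mul,
      hp.pow_eq_one]; simp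
  have : ∀ a : Fin D, star (ω ^ (y' * a : ℕ)) * ω ^ (y * a : ℕ) = z ^ (a : ℕ) := by
    intro a
    simp only [z]
    rw [mul_pow, ← star_pow, ← pow_mul, ← pow_mul]
  simp only [this]
  rw [Fin.sum_univ_eq_sum_range (fun a => z ^ a), geom_sum_eq hz, hzD]; simp

lemma ea_lower {K : ℕ} (d m : Fin K → ℕ) (hd : ∀ k, 1 ≤ d k) (hm : ∀ k, 1 ≤ m k) :
    IsEAIndepFamily (blockAlgebra d m) (∑ k, (d k) ^ 2) := by
  have : ∀ k, NeZero (d k) := fun k => ⟨by have := hd k; omega⟩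
  have : ∀ k, NeZero (m k) := fun k => ⟨by have := hm k; omega⟩
  let n := ∏ k, d k
  have hn : 1 ≤ n := Finset.one_le_prod' fun k _ => hd k
  have hdv : ∀ k, ∃ t, n = d k * t := fun k => Finset.dvd_prod_of_mem d (Finset.mem_univ k)
  choose t ht using hdv
  have htn : ∀ k, t k ≤ n := fun k => by
    rw [ht k]; exact Nat.le_mul_of_pos_left _ (hd k)
  let e : ∀ k, Fin n ≃ Fin (d k) × Fin (t k) := fun k =>
    (finCongr (ht k)).trans finProdFinEquiv.symm
  let g : Fin (∑ k, (d k) ^ 2) ≃ ((k : Fin K) × (Fin (d k) × Fin (d k))) :=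
    (Fintype.equivFinOfCardEq (by simp [sq])).symm
  let φ : ((k : Fin K) × (Fin (d k) × Fin (d k))) → Fin n → BlockIdx d m × Fin n :=
    fun i s => (⟨i.1, (e i.1 s).1 + i.2.1, 0⟩, Fin.castLE (htn i.1) (e i.1 s).2)
  let u : ((k : Fin K) × (Fin (d k) × Fin (d k))) → Fin n → ℂ :=
    fun i s => Complex.exp (2 * Real.pi * Complex.I / d i.1) ^ (i.2.2 * (e i.1 s).1 : ℕ)
  have hφ : ∀ i, Function.Injective (φ i) := by
    intro i s s' h
    simp only [φ, Prod.mk.injEq, Sigma.mk.injEq, heq_eq_eq, true_and, and_true,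
      add_left_inj] at h
    apply (e i.1).injective
    exact Prod.ext h.1 (Fin.castLE_injective _ h.2)
  have hu : ∀ i s, star (u i s) * u i s = 1 := by
    intro i s
    have hp := Complex.isPrimitiveRoot_exp (d i.1) (NeZero.ne _)
    simp only [u]
    rw [Complex.star_def, Complex.conj_mul', norm_pow, hp.norm'_eq_one (NeZero.ne _)]; simp
  let V : ((k : Fin K) × (Fin (d k) × Fin (d k))) → Matrix (BlockIdx d m × Fin n) (Fin n) ℂ :=
    fun i z s => if z = φ i s then u i s else 0
  have hVa : ∀ i z s, V i z s = if z = φ i s then u i s else 0 := fun _ _ _ => rfl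
  have htrace : ∀ i j (X : Matrix (BlockIdx d m × Fin n) (BlockIdx d m × Fin n) ℂ),
      (Xᴴ * (V i * (V j)ᴴ)).trace =
        ∑ s, star (u j s) * u i s * star (X (φ i s) (φ j s)) := by
    intro i j X
    rw [← Matrix.mul_assoc, trace_mul_comm, trace]
    refine Finset.sum_congr rfl fun s => ?_
    intro _
    simp only [diag, mul_apply, conjTranspose_apply, hVa]
    simp [apply_ite star]
    ring
  refine ⟨n, n, hn, hn, ((n : ℂ)⁻¹) • 1, ⟨?_, ?_⟩, fun i => V (g i), ?_, ?_⟩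
  · exact PosSemidef.one.smul (by
      rw [← Complex.ofReal_natCast, ← Complex.ofReal_inv]
      exact_mod_cast (by positivity : (0:ℝ) ≤ (n:ℝ)⁻¹))
  · rw [trace_smul, trace_one]
    have : (n : ℂ) ≠ 0 := by exact_mod_cast (by omega : n ≠ 0)
    simp [this]
  · intro i
    ext s s'
    simp only [mul_apply, conjTranspose_apply, hVa]
    simp only [apply_ite star, star_zero, ite_mul, zero_mul, mul_ite, mul_zero]
    by_cases h : s = s'
    · subst h
      simp [← hu (g i) s]
    · rw [one_apply_ne h]
      refine Finset.sum_eq_zero fun z _ => ?_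
      split_ifs with h1 h2 
      · exact absurd (hφ _ (h1.symm.trans h2)) (by first | exact h | exact Ne.symm h)
      all_goals rfl
  · intro i i' hii Y hY W
    beta_reduce
    have hne : g i ≠ g i' := fun h => hii (g.injective h)
    generalize g i = p at hne
    generalize g i' = q at hne
    rw [Matrix.mul_smul, Matrix.mul_one, Matrix.smul_mul, Matrix.mul_smul, trace_smul, htrace]
    suffices hs : ∑ s, star (u q s) * u p s * star ((Y ⊗ₖ W) (φ p s) (φ q s)) = 0 by
      rw [hs]; simp
    induction hY using Submodule.span_induction with
    | zero => simp
    | add Y Y' _ _ h1 h2 =>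
      simp only [kroneckerMap_apply, Matrix.add_apply, add_mul, star_add, mul_add,
        Finset.sum_add_distrib] at h1 h2 ⊢
      rw [h1, h2, add_zero]
    | smul c Y _ h1 =>
      simp only [kroneckerMap_apply, Matrix.smul_apply, smul_eq_mul, mul_assoc] at h1 ⊢
      rw [← mul_zero (star c), ← h1, Finset.mul_sum]
      refine Finset.sum_congr rfl fun s _ => ?_
      simp only [star_mul']
      ring
    | mem Y hY =>
      obtain ⟨k, B, rfl⟩ := hY
      obtain ⟨k₁, x, y⟩ := p
      obtain ⟨k₂, x', y'⟩ := q
      by_cases h1 : k₁ = k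
      swap
      · refine Finset.sum_eq_zero fun s _ => ?_
        rw [kroneckerMap_apply, blockMatrix_left _ _ _ _ _ _ h1]; simp
      by_cases h2 : k₂ = k
      swap
      · refine Finset.sum_eq_zero fun s _ => ?_
        rw [kroneckerMap_apply, blockMatrix_right _ _ _ _ _ _ h2]; simp
      subst h1
      subst h2
      simp only [kroneckerMap_apply, φ, blockMatrix_same]
      by_cases hx : x = x'
      swap
      · refine Finset.sum_eq_zero fun s _ => ?_
        rw [if_neg (by simpa using hx)]; simp
      subst hx
      have hy : y ≠ y' := fun h => hne (by rw [h])
      simp only [if_true, u]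
      rw [← (e k₂).symm.sum_comp, Fintype.sum_prod_type, Finset.sum_comm]
      refine Finset.sum_eq_zero fun c _ => ?_
      simp only [Equiv.apply_symm_apply]
      rw [← Finset.sum_mul, ea_root_sum _ (hd _) y y' hy, zero_mul]

/-- The entanglement-assisted independence number of the block *-algebra
`⊕ₖ (1_{d k} ⊗ M_{m k}(ℂ))` is `∑ₖ (d k)²`: there is an entanglement-assisted independent
family of that size, and no larger one. -/
theorem eaIndepNumber_blockAlgebra
    (K : ℕ) (hK : 1 ≤ K) (d m : Fin K → ℕ) (hd : ∀ k, 1 ≤ d k) (hm : ∀ k, 1 ≤ m k) :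
    IsEAIndepFamily (blockAlgebra d m) (∑ k, (d k) ^ 2) ∧
    (∀ M : ℕ, IsEAIndepFamily (blockAlgebra d m) M → M ≤ ∑ k, (d k) ^ 2) := by
  exact ⟨ea_lower d m hd hm, fun M h => ea_upper d m M h⟩
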